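/- (Γ-liminf inequality in the critical regime, Theorem 4.5, laminate case A' ≠ B'.) Fix γ ∈ (0,∞) and assume W is continuous and satisfies (H1), (H2) and the normalization of the wells with a ≠ 0. Let (u, b) be the laminate configuration with interfaces α₁ < ⋯ < α_m. Then for all sequences h_n → 0⁺, ε_n → 0⁺ with h_n/ε_n → γ and all C² maps u_n : Ω → ℝ³ with ∫_Ω |u_n − u| dx → 0 and ∫_Ω |h_n⁻¹∂₃u_n − b| dx → 0, one has liminf_{n→∞} F^{h_n}_{ε_n}(u_n, Ω) ≥ K*_γ · Σ_{i=1}^m ℒ¹(J_i). -/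

import Mathlib

open MeasureTheory Filter Topology ENNReal NNReal Set

noncomputable section

/-- Vectors in ℝ³. -/
abbrev V3 := Fin 3 → ℝ

/-- 3×3 matrices, represented as the triple of their columns. -/
abbrev M33 := Fin 3 → V3

/-- Euclidean norm on ℝ³. -/
def vnorm (v : V3) : ℝ := Real.sqrt (∑ i, (v i) ^ 2)

/-- Frobenius (Euclidean) norm on 3×3 matrices. -/
def mnorm (ξ : M33) : ℝ := Real.sqrt (∑ j, ∑ i, (ξ j i) ^ 2)

/-- dist(ξ,{A,B}). -/
def mdist (A B ξ : M33) : ℝ := min (mnorm (ξ - A)) (mnorm (ξ - B))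

/-- Spatial points of ℝ³ = ℝ × ℝ × ℝ. -/
abbrev Pt := ℝ × ℝ × ℝ

/-- Directional partial derivative of a map `u : ℝ³ → ℝ³`. -/
def pd (e : Pt) (u : Pt → V3) (x : Pt) : V3 := fderiv ℝ u x e

def e1 : Pt := (1, 0, 0)
def e2 : Pt := (0, 1, 0)
def e3 : Pt := (0, 0, 1)

/-- Rescaled gradient ∇_h u = (∂₁u, ∂₂u, h⁻¹ ∂₃u), as a 3×3 matrix of columns. -/
def gradh (h : ℝ) (u : Pt → V3) (x : Pt) : M33 :=
  ![pd e1 u x, pd e2 u x, h⁻¹ • pd e3 u x]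

/-- Squared rescaled Hessian |∇²_h u|². -/
def hessh (h : ℝ) (u : Pt → V3) (x : Pt) : ℝ :=
  (vnorm (pd e1 (pd e1 u) x)) ^ 2 + (vnorm (pd e2 (pd e2 u) x)) ^ 2
    + (h⁻¹) ^ 4 * (vnorm (pd e3 (pd e3 u) x)) ^ 2
    + 2 * (vnorm (pd e2 (pd e1 u) x)) ^ 2
    + 2 * (h⁻¹) ^ 2 * (vnorm (pd e3 (pd e1 u) x)) ^ 2
    + 2 * (h⁻¹) ^ 2 * (vnorm (pd e3 (pd e2 u) x)) ^ 2

/-- The energy F^h_ε(u, S) = ∫_S (1/ε) W(∇_h u) + ε |∇²_h u|², valued in [0,∞]. -/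
def F (W : M33 → ℝ) (h ε : ℝ) (u : Pt → V3) (S : Set Pt) : ℝ≥0∞ :=
  ∫⁻ x in S, ENNReal.ofReal (ε⁻¹ * W (gradh h u x) + ε * hessh h u x)

/-- Hypothesis (H1): W ≥ 0, {W = 0} = {A, B}, A ≠ B, and A' − B' = 2 a ⊗ ν̄ for
some a ∈ ℝ³ and a unit vector ν̄ ∈ ℝ². -/
def H1 (W : M33 → ℝ) (A B : M33) : Prop :=
  (∀ ξ, 0 ≤ W ξ) ∧ (∀ ξ, W ξ = 0 ↔ ξ = A ∨ ξ = B) ∧ A ≠ B ∧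
    ∃ (a : V3) (ν : ℝ × ℝ), ν.1 ^ 2 + ν.2 ^ 2 = 1 ∧
      A 0 - B 0 = (2 * ν.1) • a ∧ A 1 - B 1 = (2 * ν.2) • a

/-- Hypothesis (H2): p-growth from above and below. -/
def H2 (W : M33 → ℝ) (p : ℝ) : Prop :=
  ∃ C > (0 : ℝ), ∀ ξ, C⁻¹ * (mnorm ξ) ^ p - C ≤ W ξ ∧ W ξ ≤ C * (mnorm ξ) ^ p + C

/-- Hypothesis (H3): non-degeneracy near the wells. -/
def H3 (W : M33 → ℝ) (A B : M33) (p : ℝ) : Prop :=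
  ∃ ϱ > (0 : ℝ), ∃ C > (0 : ℝ), ∀ ξ, mdist A B ξ ≤ ϱ →
    C⁻¹ * (mdist A B ξ) ^ p ≤ W ξ ∧ W ξ ≤ C * (mdist A B ξ) ^ p

/-- Hypothesis (H4): W(ξ₁, 0, ξ₃) ≤ W(ξ). -/
def H4 (W : M33 → ℝ) : Prop := ∀ ξ : M33, W ![ξ 0, 0, ξ 2] ≤ W ξ

/-- Normalization of the wells: A = −B, first column of A is a, second column is 0. -/
def Wells (A B : M33) (a : V3) : Prop := A = -B ∧ A 0 = a ∧ A 1 = 0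

/-- ū₀(t) = |t| a. -/
def ub0 (a : V3) (t : ℝ) : V3 := |t| • a

/-- b̄₀(t) = A₃ for t ≥ 0, −A₃ (= B₃) for t < 0. -/
def bb0 (A3 : V3) (t : ℝ) : V3 := if 0 ≤ t then A3 else -A3

/-- u₀(x) = ū₀(x₁). -/
def u0 (a : V3) (x : Pt) : V3 := ub0 a x.1

/-- b₀(x) = b̄₀(x₁). -/
def b0 (A3 : V3) (x : Pt) : V3 := bb0 A3 x.1

/-- The interval I = (−1/2, 1/2). -/
def II : Set ℝ := Set.Ioo (-(1 / 2 : ℝ)) (1 / 2)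

/-- The unit cube Q = I × I × I. -/
def Q3 : Set Pt := II ×ˢ (II ×ˢ II)

/-- J_ρ = (ρ I) × J × I. -/
def Jrho (J : Set ℝ) (ρ : ℝ) : Set Pt := (Set.Ioo (-(ρ / 2)) (ρ / 2)) ×ˢ (J ×ˢ II)

/-- The rescaled thin domain Ω = ω × I. -/
def Om (ω : Set (ℝ × ℝ)) : Set Pt := {x | (x.1, x.2.1) ∈ ω ∧ x.2.2 ∈ II}

/-- L¹ convergence on a set U. -/
def TendsL1 (U : Set Pt) (f : ℕ → Pt → V3) (g : Pt → V3) : Prop :=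
  Tendsto (fun n => ∫⁻ x in U, ENNReal.ofReal (vnorm (f n x - g x))) atTop (nhds 0)

/-- L^q convergence on a set U. -/
def TendsLp (U : Set Pt) (q : ℝ) (f : ℕ → Pt → V3) (g : Pt → V3) : Prop :=
  Tendsto (fun n => ∫⁻ x in U, ENNReal.ofReal ((vnorm (f n x - g x)) ^ q)) atTop (nhds 0)

/-- The localized asymptotic energy 𝓔_γ(J, ρ). -/
def Egam (W : M33 → ℝ) (a A3 : V3) (γ : ℝ) (J : Set ℝ) (ρ : ℝ) : ℝ≥0∞ :=
  sInf { L : ℝ≥0∞ | ∃ (h ε : ℕ → ℝ) (u : ℕ → Pt → V3),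
    (∀ n, 0 < h n) ∧ (∀ n, 0 < ε n) ∧
    Tendsto h atTop (nhds 0) ∧ Tendsto ε atTop (nhds 0) ∧
    Tendsto (fun n => h n / ε n) atTop (nhds γ) ∧
    (∀ n, ContDiffOn ℝ 2 (u n) (Jrho J ρ)) ∧
    TendsL1 (Jrho J ρ) u (u0 a) ∧
    TendsL1 (Jrho J ρ) (fun n x => (h n)⁻¹ • pd e3 (u n) x) (b0 A3) ∧
    L = Filter.liminf (fun n => F W (h n) (ε n) (u n) (Jrho J ρ)) atTop }

/-- K*_γ = 𝓔_γ(I, 1). -/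
def Kstar (W : M33 → ℝ) (a A3 : V3) (γ : ℝ) : ℝ≥0∞ := Egam W a A3 γ II 1

/-- K*_∞ : the analogue of K*_γ for h/ε → ∞, on the unit cube Q. -/
def KstarInf (W : M33 → ℝ) (a A3 : V3) : ℝ≥0∞ :=
  sInf { L : ℝ≥0∞ | ∃ (h ε : ℕ → ℝ) (u : ℕ → Pt → V3),
    (∀ n, 0 < h n) ∧ (∀ n, 0 < ε n) ∧
    Tendsto h atTop (nhds 0) ∧ Tendsto ε atTop (nhds 0) ∧
    Tendsto (fun n => h n / ε n) atTop atTop ∧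
    (∀ n, ContDiffOn ℝ 2 (u n) Q3) ∧
    TendsL1 Q3 u (u0 a) ∧
    TendsL1 Q3 (fun n x => (h n)⁻¹ • pd e3 (u n) x) (b0 A3) ∧
    L = Filter.liminf (fun n => F W (h n) (ε n) (u n) Q3) atTop }

open Classical in
/-- The phase matrix: B on E, A off E. -/
def Mfun (A B : M33) (E : Set (ℝ × ℝ)) (x' : ℝ × ℝ) : M33 := if x' ∈ E then B else A

/-! ### Two-dimensional objects -/

abbrev Pt2 := ℝ × ℝ

/-- Directional partial derivative of a map `v : ℝ² → ℝ³`. -/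
def qd (e : Pt2) (v : Pt2 → V3) (y : Pt2) : V3 := fderiv ℝ v y e

def f1 : Pt2 := (1, 0)
def f2 : Pt2 := (0, 1)

/-- 𝒲(∇v) = W(∂₁v, 0, ∂₂v). -/
def W2 (W : M33 → ℝ) (v : Pt2 → V3) (y : Pt2) : ℝ := W ![qd f1 v y, 0, qd f2 v y]

/-- Squared 2D Hessian |∇²v|². -/
def hess2d (v : Pt2 → V3) (y : Pt2) : ℝ :=
  (vnorm (qd f1 (qd f1 v) y)) ^ 2 + 2 * (vnorm (qd f2 (qd f1 v) y)) ^ 2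
    + (vnorm (qd f2 (qd f2 v) y)) ^ 2

/-- The rectangle ℓI × γI. -/
def Rect (ℓ γ : ℝ) : Set Pt2 := Set.Ioo (-(ℓ / 2)) (ℓ / 2) ×ˢ Set.Ioo (-(γ / 2)) (γ / 2)

/-- The optimal-profile constant K_γ of the critical regime. -/
def Kgam (W : M33 → ℝ) (a A3 : V3) (γ : ℝ) : ℝ≥0∞ :=
  sInf { L : ℝ≥0∞ | ∃ ℓ > (0 : ℝ), ∃ v : Pt2 → V3,
    ContDiffOn ℝ 2 v (Rect ℓ γ) ∧
    (∃ δ > (0 : ℝ), ∀ y ∈ Rect ℓ γ, ℓ / 2 - δ < y.1 → qd f1 v y = a ∧ qd f2 v y = A3) ∧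
    (∃ δ > (0 : ℝ), ∀ y ∈ Rect ℓ γ, y.1 < -(ℓ / 2) + δ → qd f1 v y = -a ∧ qd f2 v y = -A3) ∧
    L = ENNReal.ofReal γ⁻¹ *
      ∫⁻ y in Rect ℓ γ, ENNReal.ofReal (W2 W v y + hess2d v y) }

/-- The 2D subcritical functional F⁰_ε(u, b, D). -/
def F0 (W : M33 → ℝ) (ε : ℝ) (u b : Pt2 → V3) (D : Set Pt2) : ℝ≥0∞ :=
  ∫⁻ y in D, ENNReal.ofReal (ε⁻¹ * W ![qd f1 u y, qd f2 u y, b y]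
    + ε * ((vnorm (qd f1 (qd f1 u) y)) ^ 2 + 2 * (vnorm (qd f2 (qd f1 u) y)) ^ 2
      + (vnorm (qd f2 (qd f2 u) y)) ^ 2
      + 2 * (vnorm (qd f1 b y)) ^ 2 + 2 * (vnorm (qd f2 b y)) ^ 2))

/-- K*₀: the subcritical cell constant. -/
def Kstar0 (W : M33 → ℝ) (a A3 : V3) : ℝ≥0∞ :=
  sInf { L : ℝ≥0∞ | ∃ (ε : ℕ → ℝ) (u b : ℕ → Pt2 → V3),
    (∀ n, 0 < ε n) ∧ Tendsto ε atTop (nhds 0) ∧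
    (∀ n, ContDiffOn ℝ 2 (u n) (II ×ˢ II)) ∧ (∀ n, ContDiffOn ℝ 1 (b n) (II ×ˢ II)) ∧
    Tendsto (fun n => ∫⁻ y in II ×ˢ II,
      ENNReal.ofReal (vnorm (u n y - ub0 a y.1) + vnorm (b n y - bb0 A3 y.1)))
      atTop (nhds 0) ∧
    L = Filter.liminf (fun n => F0 W (ε n) (u n) (b n) (II ×ˢ II)) atTop }

/-- K₀: the subcritical optimal-profile constant. -/
def K0 (W : M33 → ℝ) (a A3 : V3) : ℝ≥0∞ :=
  sInf { L : ℝ≥0∞ | ∃ ℓ > (0 : ℝ), ∃ φ1 φ2 : ℝ → V3,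
    ContDiffOn ℝ 1 φ1 (Set.Icc (-ℓ) ℓ) ∧ ContDiffOn ℝ 1 φ2 (Set.Icc (-ℓ) ℓ) ∧
    φ1 ℓ = a ∧ φ2 ℓ = A3 ∧ φ1 (-ℓ) = -a ∧ φ2 (-ℓ) = -A3 ∧
    L = ∫⁻ t in Set.Ioo (-ℓ) ℓ, ENNReal.ofReal (W ![φ1 t, 0, φ2 t]
      + (vnorm (derivWithin φ1 (Set.Icc (-ℓ) ℓ) t)) ^ 2
      + 2 * (vnorm (derivWithin φ2 (Set.Icc (-ℓ) ℓ) t)) ^ 2) }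

/-- K_∞ in the case λ = 0. -/
def KinfZero (W : M33 → ℝ) (a : V3) : ℝ≥0∞ :=
  sInf { L : ℝ≥0∞ | ∃ ℓ > (0 : ℝ), ∃ v : Pt2 → V3,
    ContDiff ℝ 2 v ∧ (∀ y : Pt2, v (y.1, y.2 + 1) = v y) ∧
    (∃ δ > (0 : ℝ), ∀ y : Pt2, |y.1 - 1 / 2| < δ → qd f1 v y = a ∧ qd f2 v y = 0) ∧
    (∃ δ > (0 : ℝ), ∀ y : Pt2, |y.1 + 1 / 2| < δ → qd f1 v y = -a ∧ qd f2 v y = 0) ∧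
    L = ∫⁻ y in II ×ˢ II, ENNReal.ofReal (ℓ * W2 W v y + ℓ⁻¹ * hess2d v y) }

/-- The unit normal ν_λ = (1+λ²)^{-1/2} (1, λ). -/
def nuv (lam : ℝ) : Pt2 := (1 / Real.sqrt (1 + lam ^ 2), lam / Real.sqrt (1 + lam ^ 2))

/-- The orthogonal direction ν_λ^⊥ = (1+λ²)^{-1/2} (−λ, 1). -/
def nupv (lam : ℝ) : Pt2 := (-lam / Real.sqrt (1 + lam ^ 2), 1 / Real.sqrt (1 + lam ^ 2))

/-- Dot product on ℝ². -/
def dotp (w y : Pt2) : ℝ := w.1 * y.1 + w.2 * y.2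

/-- The unit square Q'_λ centered at 0 with two sides orthogonal to ν_λ. -/
def Qlam (lam : ℝ) : Set Pt2 := {y | |dotp (nuv lam) y| < 1 / 2 ∧ |dotp (nupv lam) y| < 1 / 2}

/-- K_∞ for general λ. -/
def KinfL (W : M33 → ℝ) (a : V3) (lam : ℝ) : ℝ≥0∞ :=
  ENNReal.ofReal (Real.sqrt (1 + lam ^ 2)) *
    sInf { L : ℝ≥0∞ | ∃ ℓ > (0 : ℝ), ∃ v : Pt2 → V3,
      ContDiff ℝ 2 v ∧ (∀ y : Pt2, v (y + nupv lam) = v y) ∧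
      (∃ δ > (0 : ℝ), ∀ y : Pt2, |dotp (nuv lam) y - 1 / 2| < δ →
        qd f1 v y = a ∧ qd f2 v y = lam • a) ∧
      (∃ δ > (0 : ℝ), ∀ y : Pt2, |dotp (nuv lam) y + 1 / 2| < δ →
        qd f1 v y = -a ∧ qd f2 v y = -(lam • a)) ∧
      L = ∫⁻ y in Qlam lam, ENNReal.ofReal (ℓ * W2 W v y + ℓ⁻¹ * hess2d v y) }

/-- Number of interfaces strictly below t. -/
def cnt (m : ℕ) (α : Fin m → ℝ) (t : ℝ) : ℕ := (Finset.univ.filter (fun i => α i < t)).card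

end

/-- The linear map `(x₁, x₂, x₃) ↦ (θ x₁, θ x₂, τ x₃)`. -/
def diagMap (θ τ : ℝ) : Pt →L[ℝ] Pt :=
  (θ • ContinuousLinearMap.id ℝ ℝ).prodMap
    ((θ • ContinuousLinearMap.id ℝ ℝ).prodMap (τ • ContinuousLinearMap.id ℝ ℝ))

@[simp]
lemma diagMap_apply (θ τ : ℝ) (x : Pt) :
    diagMap θ τ x = (θ * x.1, θ * x.2.1, τ * x.2.2) := by
  rfl

lemma det_diagMap (θ τ : ℝ) : (diagMap θ τ).det = θ * (θ * τ) := by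
  have h : ((diagMap θ τ : Pt →L[ℝ] Pt) : Pt →ₗ[ℝ] Pt) =
      (θ • LinearMap.id (R := ℝ) (M := ℝ)).prodMap
        ((θ • LinearMap.id (R := ℝ) (M := ℝ)).prodMap (τ • LinearMap.id (R := ℝ) (M := ℝ))) :=
    rfl
  rw [ContinuousLinearMap.det, h, LinearMap.det_prodMap, LinearMap.det_prodMap]
  simp

/-- The linear equivalence underlying `diagMap`. -/
noncomputable def diagEquiv {θ τ : ℝ} (hθ : θ ≠ 0) (hτ : τ ≠ 0) : Pt ≃L[ℝ] Pt :=
  ContinuousLinearEquiv.equivOfInverse (diagMap θ τ) (diagMap θ⁻¹ τ⁻¹)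
    (fun x => by simp [hθ, hτ]) (fun x => by simp [hθ, hτ])

lemma pd_comp_diagMap {θ τ : ℝ} (hθ : θ ≠ 0) (hτ : τ ≠ 0) (e p : Pt) (u : Pt → V3) (x : Pt) :
    pd e (fun y => u (diagMap θ τ y + p)) x = pd (diagMap θ τ e) u (diagMap θ τ x + p) := by
  have h := (diagEquiv hθ hτ).comp_right_fderiv (f := fun z => u (z + p)) (x := x)
  have h' : (fun y => u (diagMap θ τ y + p)) = (fun z => u (z + p)) ∘ (diagEquiv hθ hτ) := rfl
  rw [pd, h', h, fderiv_comp_add_right]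
  rfl

lemma pd_smul_dir (k : ℝ) (e : Pt) (u : Pt → V3) (x : Pt) : pd (k • e) u x = k • pd e u x := by
  simp [pd]

lemma pd_const_smul (k : ℝ) (e : Pt) (u : Pt → V3) (x : Pt) :
    pd e (fun y => k • u y) x = k • pd e u x := by
  have h := congrFun (fderiv_const_smul_field (𝕜 := ℝ) (f := u) k) x
  change fderiv ℝ (k • u) x e = _
  rw [h]
  rfl

lemma pd_sub_const (c : V3) (e : Pt) (u : Pt → V3) (x : Pt) :
    pd e (fun y => u y - c) x = pd e u x := by
  simp [pd, fderiv_sub_const]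

lemma vnorm_smul (k : ℝ) (v : V3) : vnorm (k • v) = |k| * vnorm v := by
  simp only [vnorm, Pi.smul_apply, smul_eq_mul, mul_pow, ← Finset.mul_sum]
  rw [Real.sqrt_mul (sq_nonneg k), Real.sqrt_sq_eq_abs]

/-- Affine rescaling (with a possible point reflection) of a map `u` about the point `p`. -/
noncomputable def rescale (θ τ : ℝ) (p : Pt) (c : V3) (u : Pt → V3) (x : Pt) : V3 :=
  θ⁻¹ • (u (diagMap θ τ x + p) - c)

lemma diagMap_e1 (θ τ : ℝ) : diagMap θ τ e1 = θ • e1 := by simp [e1]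
lemma diagMap_e2 (θ τ : ℝ) : diagMap θ τ e2 = θ • e2 := by simp [e2]
lemma diagMap_e3 (θ τ : ℝ) : diagMap θ τ e3 = τ • e3 := by simp [e3]

lemma pd_rescale {θ τ : ℝ} (hθ : θ ≠ 0) (hτ : τ ≠ 0) (p : Pt) (c : V3) (u : Pt → V3)
    (e x : Pt) :
    pd e (rescale θ τ p c u) x = θ⁻¹ • pd (diagMap θ τ e) u (diagMap θ τ x + p) := by
  have h1 := pd_const_smul θ⁻¹ e (fun y => u (diagMap θ τ y + p) - c) x
  rw [pd_sub_const, pd_comp_diagMap hθ hτ] at h1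
  exact h1

lemma pd_rescale_e1 {θ τ : ℝ} (hθ : θ ≠ 0) (hτ : τ ≠ 0) (p : Pt) (c : V3) (u : Pt → V3) :
    pd e1 (rescale θ τ p c u) = fun x => pd e1 u (diagMap θ τ x + p) := by
  funext x
  rw [pd_rescale hθ hτ, diagMap_e1, pd_smul_dir, inv_smul_smul₀ hθ]

lemma pd_rescale_e2 {θ τ : ℝ} (hθ : θ ≠ 0) (hτ : τ ≠ 0) (p : Pt) (c : V3) (u : Pt → V3) :
    pd e2 (rescale θ τ p c u) = fun x => pd e2 u (diagMap θ τ x + p) := by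
  funext x
  rw [pd_rescale hθ hτ, diagMap_e2, pd_smul_dir, inv_smul_smul₀ hθ]

lemma pd_rescale_e3 {θ τ : ℝ} (hθ : θ ≠ 0) (hτ : τ ≠ 0) (p : Pt) (c : V3) (u : Pt → V3) :
    pd e3 (rescale θ τ p c u) = fun x => (θ⁻¹ * τ) • pd e3 u (diagMap θ τ x + p) := by
  funext x
  rw [pd_rescale hθ hτ, diagMap_e3, pd_smul_dir, smul_smul]

lemma vnorm_smul_sq (k : ℝ) (v : V3) : vnorm (k • v) ^ 2 = k ^ 2 * vnorm v ^ 2 := by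
  rw [vnorm_smul, mul_pow, sq_abs]

lemma gradh_rescale {s τ : ℝ} (hs : 0 < s) (hτ : τ ^ 2 = 1) (h : ℝ) (p : Pt) (c : V3)
    (u : Pt → V3) (x : Pt) :
    gradh (h / s) (rescale (τ * s) τ p c u) x = gradh h u (diagMap (τ * s) τ x + p) := by
  have hτ0 : τ ≠ 0 := by rintro rfl; norm_num at hτ
  have hθ : τ * s ≠ 0 := mul_ne_zero hτ0 hs.ne'
  have hk : (h / s)⁻¹ * ((τ * s)⁻¹ * τ) = h⁻¹ := by
    rw [inv_div]; field_simp
  rw [gradh, gradh, pd_rescale_e1 hθ hτ0, pd_rescale_e2 hθ hτ0, pd_rescale_e3 hθ hτ0, smul_smul, hk]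

lemma hessh_rescale {s τ : ℝ} (hs : 0 < s) (hτ : τ ^ 2 = 1) (h : ℝ) (p : Pt) (c : V3)
    (u : Pt → V3) (x : Pt) :
    hessh (h / s) (rescale (τ * s) τ p c u) x =
      s ^ 2 * hessh h u (diagMap (τ * s) τ x + p) := by
  have hτ0 : τ ≠ 0 := by rintro rfl; norm_num at hτ
  have hθ : τ * s ≠ 0 := mul_ne_zero hτ0 hs.ne'
  rw [hessh, hessh, pd_rescale_e1 hθ hτ0, pd_rescale_e2 hθ hτ0, pd_rescale_e3 hθ hτ0]
  simp only [pd_const_smul, pd_comp_diagMap hθ hτ0, diagMap_e1, diagMap_e2, diagMap_e3,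
    pd_smul_dir, vnorm_smul_sq]
  have hk : (h / s)⁻¹ = h⁻¹ * s := by rw [inv_div, div_eq_inv_mul]
  have h33 : s ^ 4 * (((τ * s)⁻¹ * τ) ^ 2 * τ ^ 2) = s ^ 2 := by
    rw [← mul_pow, show (τ * s)⁻¹ * τ * τ = τ / s by field_simp, div_pow, hτ]
    field_simp
  rw [hk]
  generalize vnorm (pd e1 (pd e1 u) _) = V₁₁
  generalize vnorm (pd e2 (pd e2 u) _) = V₂₂
  generalize vnorm (pd e3 (pd e3 u) _) = V₃₃
  generalize vnorm (pd e2 (pd e1 u) _) = V₂₁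
  generalize vnorm (pd e3 (pd e1 u) _) = V₃₁
  generalize vnorm (pd e3 (pd e2 u) _) = V₃₂
  linear_combination
    s ^ 2 * (V₁₁ ^ 2 + V₂₂ ^ 2 + 2 * V₂₁ ^ 2 + 2 * (h⁻¹) ^ 2 * (V₃₁ ^ 2 + V₃₂ ^ 2)) * hτ
      + (h⁻¹) ^ 4 * V₃₃ ^ 2 * h33

instance isAddHaarMeasure_volume_Pt : (volume : Measure Pt).IsAddHaarMeasure :=
  Measure.prod.instIsAddHaarMeasure _ _

lemma lintegral_diagMap {s τ : ℝ} (hs : 0 < s) (hτ : τ ^ 2 = 1) (p : Pt) {S : Set Pt}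
    (hS : MeasurableSet S) (g : Pt → ℝ≥0∞) :
    ∫⁻ x in (fun x => diagMap (τ * s) τ x + p) '' S, g x =
      ENNReal.ofReal (s ^ 2) * ∫⁻ x in S, g (diagMap (τ * s) τ x + p) := by
  have hτ0 : τ ≠ 0 := by rintro rfl; norm_num at hτ
  have hθ : τ * s ≠ 0 := mul_ne_zero hτ0 hs.ne'
  have hinj : Function.Injective (fun x => diagMap (τ * s) τ x + p) :=
    (add_left_injective p).comp (diagEquiv hθ hτ0).injective
  rw [lintegral_image_eq_lintegral_abs_det_fderiv_mul (volume : Measure Pt) hS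
    (f' := fun _ => diagMap (τ * s) τ)
    (fun x _ => ((diagMap (τ * s) τ).hasFDerivAt.add_const p).hasFDerivWithinAt) hinj.injOn]
  have hdet : |(diagMap (τ * s) τ).det| = s ^ 2 := by
    have h3 : |τ| = 1 := by rw [← sq_eq_sq₀ (abs_nonneg _) zero_le_one, sq_abs, hτ, one_pow]
    rw [det_diagMap]
    simp only [abs_mul, h3, abs_of_pos hs]
    ring
  simp only [hdet]
  rw [lintegral_const_mul' _ _ ENNReal.ofReal_ne_top]

/-- The prism over the square of side `s` centred at `(x₀, y₀)`. -/
def prism (x₀ y₀ s : ℝ) : Set Pt :=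
  Ioo (x₀ - s / 2) (x₀ + s / 2) ×ˢ (Ioo (y₀ - s / 2) (y₀ + s / 2) ×ˢ II)

lemma image_prism {s τ : ℝ} (hs : 0 < s) (hτ : τ = 1 ∨ τ = -1) (x₀ y₀ : ℝ) :
    (fun x => diagMap (τ * s) τ x + (x₀, y₀, 0)) '' Jrho II 1 = prism x₀ y₀ s := by
  ext ⟨x, y, z⟩
  simp only [Jrho, prism, II, mem_image, mem_prod, mem_Ioo, Prod.exists, diagMap_apply,
    Prod.mk_add_mk, Prod.mk.injEq]
  constructor
  · rintro ⟨x', y', z', ⟨⟨h1, h2⟩, ⟨h3, h4⟩, h5, h6⟩, rfl, rfl, rfl⟩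
    rcases hτ with rfl | rfl <;> refine ⟨⟨?_, ?_⟩, ⟨?_, ?_⟩, ?_, ?_⟩ <;> nlinarith
  · rintro ⟨⟨h1, h2⟩, ⟨h3, h4⟩, h5, h6⟩
    refine ⟨τ * ((x - x₀) / s), τ * ((y - y₀) / s), τ * z, ?_, ?_⟩
    · have hb1 : (x - x₀) / s < 1 / 2 := by rw [div_lt_iff₀ hs]; linarith
      have hb2 : -(1 / 2) < (x - x₀) / s := by rw [lt_div_iff₀ hs]; linarith
      have hb3 : (y - y₀) / s < 1 / 2 := by rw [div_lt_iff₀ hs]; linarith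
      have hb4 : -(1 / 2) < (y - y₀) / s := by rw [lt_div_iff₀ hs]; linarith
      rcases hτ with rfl | rfl <;> refine ⟨⟨?_, ?_⟩, ⟨?_, ?_⟩, ?_, ?_⟩ <;> linarith
    · rcases hτ with rfl | rfl <;> refine ⟨?_, ?_, ?_⟩ <;> field_simp <;> ring

lemma measurableSet_Jrho_II : MeasurableSet (Jrho II 1) :=
  measurableSet_Ioo.prod (measurableSet_Ioo.prod measurableSet_Ioo)

lemma measurableSet_prism (x₀ y₀ s : ℝ) : MeasurableSet (prism x₀ y₀ s) :=
  measurableSet_Ioo.prod (measurableSet_Ioo.prod measurableSet_Ioo)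

lemma F_rescale (W : M33 → ℝ) {s τ : ℝ} (hs : 0 < s) (hτ : τ = 1 ∨ τ = -1) (h ε : ℝ)
    (x₀ y₀ : ℝ) (c : V3) (u : Pt → V3) :
    ENNReal.ofReal s * F W (h / s) (ε / s) (rescale (τ * s) τ (x₀, y₀, 0) c u) (Jrho II 1) =
      F W h ε u (prism x₀ y₀ s) := by
  have hτ2 : τ ^ 2 = 1 := by rcases hτ with rfl | rfl <;> norm_num
  rw [F, F, ← image_prism hs hτ, lintegral_diagMap hs hτ2 _ measurableSet_Jrho_II,
    ← lintegral_const_mul' _ _ ENNReal.ofReal_ne_top,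
    ← lintegral_const_mul' _ _ ENNReal.ofReal_ne_top]
  refine lintegral_congr fun x => ?_
  rw [gradh_rescale hs hτ2, hessh_rescale hs hτ2, ← ENNReal.ofReal_mul hs.le,
    ← ENNReal.ofReal_mul (sq_nonneg s)]
  congr 1
  rw [inv_div]
  field_simp

lemma volume_fst_eq (r : ℝ) : ∀ᵐ x : Pt, x.1 ≠ r := by
  have h : ∀ᵐ t : ℝ, t ≠ r := by simp [ae_iff]
  exact Measure.quasiMeasurePreserving_fst.ae h

lemma TendsL1.rescale {s τ : ℝ} (hs : 0 < s) (hτ : τ = 1 ∨ τ = -1) {x₀ y₀ : ℝ}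
    {f f' : ℕ → Pt → V3} {g g' : Pt → V3} (k : ℝ) (hfg : TendsL1 (prism x₀ y₀ s) f g)
    (hk : ∀ᵐ x : Pt, x ∈ Jrho II 1 → ∀ n, f' n x - g' x =
      k • (f n (diagMap (τ * s) τ x + (x₀, y₀, 0)) - g (diagMap (τ * s) τ x + (x₀, y₀, 0)))) :
    TendsL1 (Jrho II 1) f' g' := by
  have hτ2 : τ ^ 2 = 1 := by rcases hτ with rfl | rfl <;> norm_num
  have hs2 : ENNReal.ofReal (s ^ 2) ≠ 0 := by simpa using hs.ne'
  have key : ∀ n, ∫⁻ x in Jrho II 1, ENNReal.ofReal (vnorm (f' n x - g' x)) =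
      ENNReal.ofReal |k| * ((ENNReal.ofReal (s ^ 2))⁻¹ *
        ∫⁻ x in prism x₀ y₀ s, ENNReal.ofReal (vnorm (f n x - g x))) := by
    intro n
    rw [← image_prism hs hτ, lintegral_diagMap hs hτ2 _ measurableSet_Jrho_II, ← mul_assoc _⁻¹,
      ENNReal.inv_mul_cancel hs2 ENNReal.ofReal_ne_top, one_mul,
      ← lintegral_const_mul' _ _ ENNReal.ofReal_ne_top]
    refine setLIntegral_congr_fun_ae measurableSet_Jrho_II ?_
    filter_upwards [hk] with x hx hxQ
    rw [hx hxQ n, vnorm_smul, ENNReal.ofReal_mul (abs_nonneg k)]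
  rw [TendsL1, funext key]
  have h1 := ENNReal.Tendsto.const_mul (a := (ENNReal.ofReal (s ^ 2))⁻¹) hfg
    (Or.inr (ENNReal.inv_ne_top.2 hs2))
  have h2 := ENNReal.Tendsto.const_mul (a := ENNReal.ofReal |k|) h1 (Or.inr ENNReal.ofReal_ne_top)
  simpa using h2

lemma ofReal_mul_Kstar_le_liminf_prism (W : M33 → ℝ) (a A3 : V3) (γ : ℝ) {s τ : ℝ} (hs : 0 < s)
    (hτ : τ = 1 ∨ τ = -1) (x₀ y₀ : ℝ) (c : V3) (ub bb : ℝ → V3)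
    (hub : ∀ x ∈ Ioo (x₀ - s / 2) (x₀ + s / 2), ub x = c + (τ * |x - x₀|) • a)
    (hbl : ∀ x ∈ Ioo (x₀ - s / 2) x₀, bb x = (-τ) • A3)
    (hbr : ∀ x ∈ Ioo x₀ (x₀ + s / 2), bb x = τ • A3)
    (h ε : ℕ → ℝ) (hh : ∀ n, 0 < h n) (hε : ∀ n, 0 < ε n)
    (hh0 : Tendsto h atTop (nhds 0)) (hε0 : Tendsto ε atTop (nhds 0))
    (hratio : Tendsto (fun n => h n / ε n) atTop (nhds γ))
    (u : ℕ → Pt → V3) (hu : ∀ n, ContDiffOn ℝ 2 (u n) (prism x₀ y₀ s))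
    (hL1u : TendsL1 (prism x₀ y₀ s) u (fun x => ub x.1))
    (hL1b : TendsL1 (prism x₀ y₀ s) (fun n x => (h n)⁻¹ • pd e3 (u n) x) (fun x => bb x.1)) :
    ENNReal.ofReal s * Kstar W a A3 γ ≤
      liminf (fun n => F W (h n) (ε n) (u n) (prism x₀ y₀ s)) atTop := by
  have hτ0 : τ ≠ 0 := by rcases hτ with rfl | rfl <;> norm_num
  have hττ : τ * τ = 1 := by rcases hτ with rfl | rfl <;> norm_num
  have hθ : τ * s ≠ 0 := mul_ne_zero hτ0 hs.ne'
  have hΦ : ∀ x ∈ Jrho II 1, diagMap (τ * s) τ x + (x₀, y₀, 0) ∈ prism x₀ y₀ s := fun x hx =>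
    image_prism hs hτ x₀ y₀ ▸ mem_image_of_mem _ hx
  have hle : Kstar W a A3 γ ≤ liminf (fun n => F W (h n / s) (ε n / s)
      (rescale (τ * s) τ (x₀, y₀, 0) c (u n)) (Jrho II 1)) atTop := by
    refine sInf_le ⟨fun n => h n / s, fun n => ε n / s,
      fun n => rescale (τ * s) τ (x₀, y₀, 0) c (u n), fun n => div_pos (hh n) hs,
      fun n => div_pos (hε n) hs, by simpa using hh0.div_const s, by simpa using hε0.div_const s,
      ?_, fun n => ?_, ?_, ?_, rfl⟩
    · simpa only [div_div_div_cancel_right₀ hs.ne'] using hratio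
    · refine ContDiffOn.const_smul _ (ContDiffOn.sub ?_ contDiffOn_const)
      exact (hu n).comp ((diagMap (τ * s) τ).contDiff.add contDiff_const).contDiffOn hΦ
    · refine hL1u.rescale hs hτ (τ * s)⁻¹ (Eventually.of_forall fun x hx n => ?_)
      have hx1 := (hΦ x hx).1
      have habs : |τ * s * x.1| = s * |x.1| := by
        rcases hτ with rfl | rfl <;> simp [abs_mul, abs_of_pos hs]
      simp only [Prod.fst_add, diagMap_apply] at hx1
      simp only [_root_.rescale, u0, ub0, Prod.fst_add, diagMap_apply, hub _ hx1,
        add_sub_cancel_right, habs, ← mul_assoc]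
      rw [← sub_sub, smul_sub _ (_ - c), smul_smul, inv_mul_cancel_left₀ hθ]
    · refine hL1b.rescale hs hτ 1 ?_
      filter_upwards [volume_fst_eq 0] with x hx0 hx n
      have hx1 := (hΦ x hx).1
      simp only [Prod.fst_add, diagMap_apply, mem_Ioo] at hx1
      have hk : (h n / s)⁻¹ * ((τ * s)⁻¹ * τ) = (h n)⁻¹ := by
        have := (hh n).ne'
        rw [inv_div]; field_simp
      have hb : bb (τ * s * x.1 + x₀) = bb0 A3 x.1 := by
        rcases lt_or_gt_of_ne hx0 with hneg | hpos
        · have := mul_neg_of_pos_of_neg hs hneg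
          rw [bb0, if_neg (not_le.2 hneg)]
          rcases hτ with rfl | rfl
          · rw [hbl _ ⟨hx1.1, by linarith⟩, neg_one_smul]
          · rw [hbr _ ⟨by linarith, hx1.2⟩, neg_one_smul]
        · have := mul_pos hs hpos
          rw [bb0, if_pos hpos.le]
          rcases hτ with rfl | rfl
          · rw [hbr _ ⟨by linarith, hx1.2⟩, one_smul]
          · rw [hbl _ ⟨hx1.1, by linarith⟩, neg_neg, one_smul]
      simp only [pd_rescale_e3 hθ hτ0, b0, smul_smul, hk, one_smul, Prod.fst_add, diagMap_apply, hb]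
  calc ENNReal.ofReal s * Kstar W a A3 γ
      ≤ ENNReal.ofReal s * liminf (fun n => F W (h n / s) (ε n / s)
          (rescale (τ * s) τ (x₀, y₀, 0) c (u n)) (Jrho II 1)) atTop := by gcongr
    _ = _ := by
      rw [← ENNReal.liminf_const_mul_of_ne_top ENNReal.ofReal_ne_top]
      simp only [F_rescale W hs hτ]

lemma sum_liminf_le_liminf_sum {ι : Type*} [Fintype ι] (f : ι → ℕ → ℝ≥0∞) :
    ∑ i, liminf (f i) atTop ≤ liminf (fun n => ∑ i, f i n) atTop := by
  let _ : MeasurableSpace ι := ⊤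
  have h := lintegral_liminf_le (μ := Measure.count) (u := atTop) (f := fun n i => f i n)
    fun _ => measurable_from_top
  simpa [lintegral_count, tsum_fintype] using h

lemma sub_eq_smul_of_hasDerivAt {f : ℝ → V3} {v : V3} {x y : ℝ} (hxy : x ≤ y) (hf : Continuous f)
    (hd : ∀ t ∈ Ioo x y, HasDerivAt f v t) : f y - f x = (y - x) • v := by
  rcases hxy.eq_or_lt with rfl | hlt
  · simp
  ext k
  obtain ⟨t, -, ht⟩ := exists_hasDerivAt_eq_slope (fun t => f t k) (fun _ => v k) hlt
    ((continuous_apply k).comp hf).continuousOn (fun t ht => hasDerivAt_pi.1 (hd t ht) k)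
  have : y - x ≠ 0 := (sub_pos.2 hlt).ne'
  simp only [Pi.sub_apply, Pi.smul_apply, smul_eq_mul, ht]
  field_simp

lemma cnt_left {m : ℕ} {α : Fin m → ℝ} (hα : StrictMono α) {i : Fin m} {r : ℝ}
    (hsep : ∀ j, j ≠ i → r ≤ |α i - α j|) {t : ℝ} (ht : t ∈ Ioo (α i - r) (α i)) :
    cnt m α t = i := by
  have : Finset.univ.filter (fun j => α j < t) = Finset.Iio i := by
    ext j
    simp only [Finset.mem_filter, Finset.mem_univ, true_and, Finset.mem_Iio]
    constructor
    · intro hj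
      exact hα.lt_iff_lt.1 (hj.trans ht.2)
    · intro hj
      have h1 := hsep j hj.ne
      rw [abs_of_pos (sub_pos.2 (hα hj))] at h1
      linarith [ht.1]
  rw [cnt, this, Fin.card_Iio]

lemma cnt_right {m : ℕ} {α : Fin m → ℝ} (hα : StrictMono α) {i : Fin m} {r : ℝ}
    (hsep : ∀ j, j ≠ i → r ≤ |α i - α j|) {t : ℝ} (ht : t ∈ Ioo (α i) (α i + r)) :
    cnt m α t = i + 1 := by
  have : Finset.univ.filter (fun j => α j < t) = Finset.Iic i := by
    ext j
    simp only [Finset.mem_filter, Finset.mem_univ, true_and, Finset.mem_Iic]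
    constructor
    · intro hj
      by_contra! hij
      have h1 := hsep j hij.ne'
      rw [abs_of_neg (sub_neg.2 (hα hij))] at h1
      linarith [ht.2]
    · intro hj
      exact (hα.monotone hj).trans_lt ht.1
  rw [cnt, this, Fin.card_Iic]

lemma profile_eq {m : ℕ} {α : Fin m → ℝ} (hα : StrictMono α) {i : Fin m} {r : ℝ}
    (hsep : ∀ j, j ≠ i → r ≤ |α i - α j|) {σ : ℝ} {a : V3} {ub : ℝ → V3} (hc : Continuous ub)
    (hub : ∀ t, t ∉ range α → HasDerivAt ub ((σ * (-1 : ℝ) ^ cnt m α t) • a) t)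
    {x : ℝ} (hx : x ∈ Ioo (α i - r) (α i + r)) :
    ub x = ub (α i) + (-(σ * (-1) ^ (i : ℕ)) * |x - α i|) • a := by
  have hout : ∀ t ∈ Ioo (α i - r) (α i + r), t ≠ α i → t ∉ range α := by
    rintro _ ht hne ⟨j, rfl⟩
    have h1 := hsep j fun hj => hne (hj ▸ rfl)
    rcases abs_cases (α i - α j) with h2 | h2 <;> linarith [ht.1, ht.2]
  rcases le_total x (α i) with hle | hle
  · have h1 := sub_eq_smul_of_hasDerivAt (v := (σ * (-1) ^ (i : ℕ)) • a) hle hc fun t ht => by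
      have h2 := hub t (hout t ⟨hx.1.trans ht.1, by linarith [ht.2, hx.1, hx.2]⟩ ht.2.ne)
      rwa [cnt_left hα hsep ⟨hx.1.trans ht.1, ht.2⟩] at h2
    rw [abs_of_nonpos (sub_nonpos.2 hle), ← sub_eq_iff_eq_add', ← neg_sub, h1, smul_smul,
      ← neg_smul]
    congr 1
    ring
  · have h1 := sub_eq_smul_of_hasDerivAt (v := (σ * (-1) ^ (i + 1 : ℕ)) • a) hle hc fun t ht => by
      have h2 := hub t (hout t ⟨by linarith [ht.1, hx.1, hx.2], ht.2.trans hx.2⟩ ht.1.ne')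
      rwa [cnt_right hα hsep ⟨ht.1, ht.2.trans hx.2⟩] at h2
    rw [abs_of_nonneg (sub_nonneg.2 hle), ← sub_eq_iff_eq_add', h1, smul_smul]
    congr 1
    ring

lemma sum_liminf_F_le {ι : Type*} [Fintype ι] (W : M33 → ℝ) (h ε : ℕ → ℝ) (u : ℕ → Pt → V3)
    {S : ι → Set Pt} {U : Set Pt} (hS : ∀ i, MeasurableSet (S i))
    (hd : Pairwise (Function.onFun Disjoint S)) (hU : ∀ i, S i ⊆ U) :
    ∑ i, liminf (fun n => F W (h n) (ε n) (u n) (S i)) atTop ≤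
      liminf (fun n => F W (h n) (ε n) (u n) U) atTop := by
  refine (sum_liminf_le_liminf_sum _).trans (liminf_le_liminf (Eventually.of_forall fun n => ?_))
  simp only [F]
  rw [← lintegral_biUnion_finset (hd.set_pairwise _) fun i _ => hS i]
  exact lintegral_mono_set (iUnion₂_subset fun i _ => hU i)

lemma TendsL1.mono {S U : Set Pt} {f : ℕ → Pt → V3} {g : Pt → V3} (h : TendsL1 U f g)
    (hS : S ⊆ U) : TendsL1 S f g :=
  tendsto_of_tendsto_of_tendsto_of_le_of_le tendsto_const_nhds h (fun _ => zero_le)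
    fun _ => lintegral_mono_set hS

lemma exists_tube {ω : Set (ℝ × ℝ)} (hω : IsOpen ω) {x₀ c d : ℝ}
    (hcd : ∀ t ∈ Icc c d, (x₀, t) ∈ ω) :
    ∃ δ > 0, ∀ x, |x - x₀| < δ → ∀ t ∈ Icc c d, (x, t) ∈ ω := by
  have hK : IsCompact ((fun t : ℝ => (x₀, t)) '' Icc c d) := isCompact_Icc.image (by fun_prop)
  obtain ⟨δ, hδ, hsub⟩ := hK.exists_thickening_subset_open hω (image_subset_iff.2 hcd)
  refine ⟨δ, hδ, fun x hx t ht => hsub ?_⟩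
  refine Metric.mem_thickening_iff.2 ⟨(x₀, t), mem_image_of_mem _ ht, ?_⟩
  simpa [Prod.dist_eq, Real.dist_eq, hδ] using hx

lemma exists_Ioo_subset_of_convex {J : Set ℝ} (hc : Convex ℝ J)
    (hb : Bornology.IsBounded J) (hne : J.Nonempty) :
    ∃ x y, x ≤ y ∧ Ioo x y ⊆ J ∧ volume J ≤ ENNReal.ofReal (y - x) := by
  refine ⟨sInf J, sSup J, csInf_le_csSup hne hb.bddBelow hb.bddAbove,
    IsConnected.Ioo_csInf_csSup_subset ⟨hne, hc.isPreconnected⟩ hb.bddBelow hb.bddAbove, ?_⟩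
  rw [← Real.volume_Icc]
  exact measure_mono (subset_Icc_csInf_csSup hb.bddBelow hb.bddAbove)

lemma exists_mem_slice {ω : Set (ℝ × ℝ)} (hc : Convex ℝ ω) (hne : ω.Nonempty) {x : ℝ}
    (h1 : sInf (Prod.fst '' ω) < x) (h2 : x < sSup (Prod.fst '' ω)) : ∃ t, (x, t) ∈ ω := by
  obtain ⟨y, hy, hyx⟩ := exists_lt_of_csInf_lt (hne.image _) h1
  obtain ⟨z, hz, hxz⟩ := exists_lt_of_lt_csSup (hne.image _) h2
  have hconv : Convex ℝ (Prod.fst '' ω) := hc.linear_image (LinearMap.fst ℝ ℝ ℝ)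
  obtain ⟨⟨x', t⟩, hmem, rfl⟩ := hconv.ordConnected.out hy hz ⟨hyx.le, hxz.le⟩
  exact ⟨t, hmem⟩

lemma prism_subset_Om {ω : Set (ℝ × ℝ)} {x₀ c d s δ : ℝ} (hsδ : s < δ)
    (htube : ∀ x, |x - x₀| < δ → ∀ t ∈ Icc c d, (x, t) ∈ ω) {y₀ : ℝ}
    (hc : c ≤ y₀ - s / 2) (hd : y₀ + s / 2 ≤ d) : prism x₀ y₀ s ⊆ Om ω := by
  rintro ⟨x, y, z⟩ ⟨⟨h1, h2⟩, ⟨h3, h4⟩, h5⟩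
  dsimp only at h1 h2 h3 h4
  exact ⟨htube x (by rw [abs_lt]; constructor <;> linarith) y
    ⟨by linarith, by linarith⟩, h5⟩

lemma disjoint_prism_of_fst {x₀ y₀ s x₁ y₁ s' : ℝ} (h : s / 2 + s' / 2 ≤ |x₀ - x₁|) :
    Disjoint (prism x₀ y₀ s) (prism x₁ y₁ s') := by
  rw [Set.disjoint_left]
  rintro ⟨x, y, z⟩ ⟨⟨h1, h2⟩, -⟩ ⟨⟨h3, h4⟩, -⟩
  dsimp only at h1 h2 h3 h4
  rcases abs_cases (x₀ - x₁) with h5 | h5 <;> linarith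

lemma disjoint_prism_of_snd {x₀ y₀ s x₁ y₁ s' : ℝ} (h : s / 2 + s' / 2 ≤ |y₀ - y₁|) :
    Disjoint (prism x₀ y₀ s) (prism x₁ y₁ s') := by
  rw [Set.disjoint_left]
  rintro ⟨x, y, z⟩ ⟨-, ⟨h1, h2⟩, -⟩ ⟨-, ⟨h3, h4⟩, -⟩
  dsimp only at h1 h2 h3 h4
  rcases abs_cases (y₀ - y₁) with h5 | h5 <;> linarith

/-- A common number of subdivisions that makes all meshes `ℓ i / N` small. -/
lemma exists_mesh {m : ℕ} {α : Fin m → ℝ} (hα : Function.Injective α) (ℓ δ : Fin m → ℝ)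
    (hδ : ∀ i, 0 < δ i) :
    ∃ N : ℕ, 0 < N ∧ (∀ i, ℓ i / N < δ i) ∧
      ∀ i j, j ≠ i → ℓ i / N / 2 + ℓ j / N / 2 ≤ |α i - α j| := by
  have hlim : ∀ i, Tendsto (fun N : ℕ => ℓ i / N) atTop (nhds 0) := fun i =>
    tendsto_const_div_atTop_nhds_zero_nat (ℓ i)
  have h1 : ∀ᶠ N : ℕ in atTop, ∀ i, ℓ i / N < δ i :=
    eventually_all.2 fun i => (hlim i).eventually_lt_const (hδ i)
  have h2 : ∀ᶠ N : ℕ in atTop, ∀ i j, j ≠ i → ℓ i / N / 2 + ℓ j / N / 2 ≤ |α i - α j| := by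
    refine eventually_all.2 fun i => eventually_all.2 fun j => ?_
    rcases eq_or_ne j i with rfl | hne
    · simp
    · have hpos : 0 < |α i - α j| := abs_pos.2 (sub_ne_zero.2 fun he => hne (hα he).symm)
      have hl : Tendsto (fun N : ℕ => ℓ i / N / 2 + ℓ j / N / 2) atTop (nhds 0) := by
        simpa using ((hlim i).div_const 2).add ((hlim j).div_const 2)
      filter_upwards [hl.eventually_lt_const hpos] with N hN _ using hN.le
  obtain ⟨N, h3, h4, h5⟩ := ((eventually_gt_atTop 0).and (h1.and h2)).exists
  exact ⟨N, h3, h4, h5⟩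

lemma Kstar_mul_sum_le_of_Icc (W : M33 → ℝ) (a A3 : V3) (γ : ℝ) {ω : Set (ℝ × ℝ)} (hω : IsOpen ω)
    {m : ℕ} {α : Fin m → ℝ} (hα : StrictMono α) {σ : ℝ} (hσ : σ = 1 ∨ σ = -1)
    {ub : ℝ → V3} (hubc : Continuous ub)
    (hub : ∀ t, t ∉ range α → HasDerivAt ub ((σ * (-1 : ℝ) ^ cnt m α t) • a) t)
    {h ε : ℕ → ℝ} (hh : ∀ n, 0 < h n) (hε : ∀ n, 0 < ε n)
    (hh0 : Tendsto h atTop (nhds 0)) (hε0 : Tendsto ε atTop (nhds 0))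
    (hratio : Tendsto (fun n => h n / ε n) atTop (nhds γ))
    {u : ℕ → Pt → V3} (hu : ∀ n, ContDiffOn ℝ 2 (u n) (Om ω))
    (hL1u : TendsL1 (Om ω) u (fun x => ub x.1))
    (hL1b : TendsL1 (Om ω) (fun n x => (h n)⁻¹ • pd e3 (u n) x)
      (fun x => (σ * (-1 : ℝ) ^ cnt m α x.1) • A3))
    {c d : Fin m → ℝ} (hcd : ∀ i, c i < d i) (hslice : ∀ i, ∀ t ∈ Icc (c i) (d i), (α i, t) ∈ ω) :
    Kstar W a A3 γ * ∑ i, ENNReal.ofReal (d i - c i) ≤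
      liminf (fun n => F W (h n) (ε n) (u n) (Om ω)) atTop := by
  choose δ hδ htube using fun i => exists_tube hω (hslice i)
  obtain ⟨N, hN, hNδ, hNα⟩ := exists_mesh hα.injective (fun i => d i - c i) δ hδ
  have hN' : (0 : ℝ) < N := Nat.cast_pos.2 hN
  set s : Fin m → ℝ := fun i => (d i - c i) / N
  have hs : ∀ i, 0 < s i := fun i => div_pos (sub_pos.2 (hcd i)) hN'
  have hNs : ∀ i, N * s i = d i - c i := fun i => mul_div_cancel₀ _ hN'.ne'
  let P : Fin m × Fin N → Set Pt := fun q =>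
    prism (α q.1) (c q.1 + ((q.2 : ℕ) + 1 / 2) * s q.1) (s q.1)
  have hPU : ∀ q, P q ⊆ Om ω := by
    rintro ⟨i, k⟩
    have hk : ((k : ℕ) : ℝ) + 1 ≤ N := by exact_mod_cast k.2
    refine prism_subset_Om (hNδ i) (htube i) ?_ ?_
    · have := mul_nonneg (Nat.cast_nonneg (α := ℝ) (k : ℕ)) (hs i).le
      linarith
    · have := mul_le_mul_of_nonneg_right hk (hs i).le
      linarith [hNs i]
  have hPd : Pairwise (Function.onFun Disjoint P) := by
    rintro ⟨i, k⟩ ⟨j, l⟩ hne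
    rcases eq_or_ne j i with rfl | hji
    · have hkl : (k : ℕ) ≠ l := fun he => hne (by rw [Fin.ext he])
      refine disjoint_prism_of_snd ?_
      have h1 : (1 : ℝ) ≤ |((k : ℕ) : ℝ) - (l : ℕ)| := by
        have : (1 : ℤ) ≤ |((k : ℕ) : ℤ) - (l : ℕ)| :=
          Int.one_le_abs (sub_ne_zero.2 (by exact_mod_cast hkl))
        exact_mod_cast this
      have h2 : c j + ((k : ℕ) + 1 / 2) * s j - (c j + ((l : ℕ) + 1 / 2) * s j) =
          (((k : ℕ) : ℝ) - (l : ℕ)) * s j := by ring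
      dsimp only
      rw [h2, abs_mul, abs_of_pos (hs j), add_halves]
      exact le_mul_of_one_le_left (hs j).le h1
    · exact disjoint_prism_of_fst (hNα i j hji)
  have hcell : ∀ q, ENNReal.ofReal (s q.1) * Kstar W a A3 γ ≤
      liminf (fun n => F W (h n) (ε n) (u n) (P q)) atTop := by
    rintro ⟨i, k⟩
    have hsep : ∀ j, j ≠ i → s i / 2 ≤ |α i - α j| := fun j hj =>
      (le_add_of_nonneg_right (half_pos (hs j)).le).trans (hNα i j hj)
    have hτ : -(σ * (-1) ^ (i : ℕ)) = 1 ∨ -(σ * (-1) ^ (i : ℕ)) = -1 := by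
      rcases hσ with rfl | rfl <;> rcases neg_one_pow_eq_or ℝ (i : ℕ) with h0 | h0 <;> simp [h0]
    refine ofReal_mul_Kstar_le_liminf_prism W a A3 γ (hs i) hτ (α i) _ (ub (α i)) ub
      (fun t => (σ * (-1 : ℝ) ^ cnt m α t) • A3)
      (fun x hx => profile_eq hα hsep hubc hub hx) (fun x hx => ?_) (fun x hx => ?_)
      h ε hh hε hh0 hε0 hratio u (fun n => (hu n).mono (hPU (i, k))) (hL1u.mono (hPU (i, k)))
      (hL1b.mono (hPU (i, k)))
    · simp only [cnt_left hα hsep hx, neg_neg]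
    · simp only [cnt_right hα hsep hx, pow_succ, mul_neg, mul_one]
  calc Kstar W a A3 γ * ∑ i, ENNReal.ofReal (d i - c i)
      = ∑ q : Fin m × Fin N, ENNReal.ofReal (s q.1) * Kstar W a A3 γ := by
        rw [Fintype.sum_prod_type, mul_comm, Finset.sum_mul]
        refine Finset.sum_congr rfl fun i _ => ?_
        dsimp only
        rw [Finset.sum_const, Finset.card_univ, Fintype.card_fin, nsmul_eq_mul, ← mul_assoc,
          ← hNs i, ENNReal.ofReal_mul hN'.le, ENNReal.ofReal_natCast]
    _ ≤ ∑ q, liminf (fun n => F W (h n) (ε n) (u n) (P q)) atTop :=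
        Finset.sum_le_sum fun q _ => hcell q
    _ ≤ _ := sum_liminf_F_le W h ε u (fun q => measurableSet_prism _ _ _) hPd hPU

lemma ENNReal.le_of_forall_ofReal_mul_le {x y : ℝ≥0∞}
    (h : ∀ t ∈ Ioo (0 : ℝ) 1, ENNReal.ofReal t * x ≤ y) : x ≤ y := by
  have hlim : Tendsto (fun t : ℝ => ENNReal.ofReal t * x) (𝓝[<] 1) (nhds (ENNReal.ofReal 1 * x)) :=
    ENNReal.Tendsto.mul_const
      (ENNReal.tendsto_ofReal (tendsto_id.mono_left nhdsWithin_le_nhds)) (Or.inl (by simp))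
  rw [ENNReal.ofReal_one, one_mul] at hlim
  refine le_of_tendsto hlim ?_
  filter_upwards [Ioo_mem_nhdsLT (zero_lt_one (α := ℝ))] with t ht using h t ht

/-- Theorem 4.5, Γ-liminf in the critical regime, laminate case A' ≠ B'. -/
theorem statement8 (p : ℝ) (hp : 2 ≤ p) (A B : M33) (W : M33 → ℝ) (a : V3) (ha : a ≠ 0)
    (hWc : Continuous W) (h1 : H1 W A B) (h2 : H2 W p)
    (hwells : Wells A B a) (γ : ℝ) (hγ : 0 < γ)
    (ω : Set (ℝ × ℝ)) (hωo : IsOpen ω) (hωc : Convex ℝ ω)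
    (hωb : Bornology.IsBounded ω) (hωne : ω.Nonempty)
    (m : ℕ) (hm : 0 < m) (α : Fin m → ℝ) (hαmono : StrictMono α)
    (hαin : ∀ i, sInf (Prod.fst '' ω) < α i ∧ α i < sSup (Prod.fst '' ω))
    (σ : ℝ) (hσ : σ = 1 ∨ σ = -1)
    (ubar : ℝ → V3) (hubarc : Continuous ubar)
    (hubar : ∀ t, t ∉ Set.range α →
      HasDerivAt ubar ((σ * (-1 : ℝ) ^ (cnt m α t)) • a) t)
    (h ε : ℕ → ℝ) (hh : ∀ n, 0 < h n) (hε : ∀ n, 0 < ε n)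
    (hh0 : Tendsto h atTop (nhds 0)) (hε0 : Tendsto ε atTop (nhds 0))
    (hratio : Tendsto (fun n => h n / ε n) atTop (nhds γ))
    (un : ℕ → Pt → V3) (hun : ∀ n, ContDiffOn ℝ 2 (un n) (Om ω))
    (hL1u : TendsL1 (Om ω) un (fun x => ubar x.1))
    (hL1b : TendsL1 (Om ω) (fun n x => (h n)⁻¹ • pd e3 (un n) x)
      (fun x => (σ * (-1 : ℝ) ^ (cnt m α x.1)) • A 2)) :
    Kstar W a (A 2) γ * (∑ i : Fin m, volume {t : ℝ | (α i, t) ∈ ω}) ≤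
      Filter.liminf (fun n => F W (h n) (ε n) (un n) (Om ω)) atTop := by
  have hJc : ∀ i, Convex ℝ {t : ℝ | (α i, t) ∈ ω} := by
    intro i t ht t' ht' r r' hr hr' hrr'
    have h3 := hωc ht ht' hr hr' hrr'
    simpa [← add_mul, hrr'] using h3
  have hJb : ∀ i, Bornology.IsBounded {t : ℝ | (α i, t) ∈ ω} := fun i =>
    hωb.image_snd.subset fun t ht => ⟨(α i, t), ht, rfl⟩
  have hJne : ∀ i, {t : ℝ | (α i, t) ∈ ω}.Nonempty := fun i =>
    exists_mem_slice hωc hωne (hαin i).1 (hαin i).2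
  have hJo : ∀ i, IsOpen {t : ℝ | (α i, t) ∈ ω} := fun i =>
    hωo.preimage (by fun_prop : Continuous fun t : ℝ => (α i, t))
  choose x y hxy hsub hvol using fun i => exists_Ioo_subset_of_convex (hJc i) (hJb i) (hJne i)
  have hlt : ∀ i, x i < y i := by
    intro i
    have h3 := ((hJo i).measure_pos volume (hJne i)).trans_le (hvol i)
    exact sub_pos.1 (ENNReal.ofReal_pos.1 h3)
  have hle : Kstar W a (A 2) γ * (∑ i : Fin m, volume {t : ℝ | (α i, t) ∈ ω}) ≤
      Kstar W a (A 2) γ * ∑ i, ENNReal.ofReal (y i - x i) := by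
    gcongr with i
    exact hvol i
  refine hle.trans (ENNReal.le_of_forall_ofReal_mul_le fun t ht => ?_)
  have hmain := Kstar_mul_sum_le_of_Icc W a (A 2) γ hωo hαmono hσ hubarc hubar hh hε hh0 hε0
    hratio hun hL1u hL1b (c := fun i => (x i + y i) / 2 - t * (y i - x i) / 2)
    (d := fun i => (x i + y i) / 2 + t * (y i - x i) / 2)
    (fun i => by linarith [mul_pos ht.1 (sub_pos.2 (hlt i))])
    (fun i r hr => hsub i (by
      have h3 := mul_lt_of_lt_one_left (sub_pos.2 (hlt i)) ht.2
      constructor <;> linarith [hr.1, hr.2]))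
  refine le_of_eq_of_le ?_ hmain
  rw [mul_left_comm, Finset.mul_sum]
  congr 1
  refine Finset.sum_congr rfl fun i _ => ?_
  rw [← ENNReal.ofReal_mul ht.1.le]
  congr 1
  ring
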